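/- arXiv:1903.02811 — 3 statements merged into one kernel-verified Lean document; each statement's English description precedes it below -/
import Mathlib

section
/- Let m, n be positive integers and let ℤ_m act on ℂ^n via a unitary matrix T ∈ U(n) with T^m = I (the element k acting as x ↦ T^k x). Then there exist a map Φ : ℂ^n → ℂ^{2n+1} and a constant C > 0 depending only on m such that: (i) Φ is ℤ_m-invariant, i.e. Φ(T x) = Φ(x) for all x ∈ ℂ^n; (ii) Φ separates orbits, i.e. Φ(x) = Φ(y) if and only if x = T^k y for some integer k; and (iii) ‖Φ(x) − Φ(y)‖ ≤ C · min_{0 ≤ k < m} ‖x − T^k y‖ for all x, y ∈ ℂ^n. -/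
open Module

/-- A `C¹` map from a space of dimension `v` admits `d`-dimensional subspaces meeting its set of
differences only at `0`, as long as they have codimension at least `2 * v + 1`. -/
theorem exists_submodule_sub_mem_imp_eq {V W : Type*} [NormedAddCommGroup V] [NormedSpace ℝ V]
    [FiniteDimensional ℝ V] [NormedAddCommGroup W] [NormedSpace ℝ W] [FiniteDimensional ℝ W]
    {P : V → W} (hP : ContDiff ℝ 1 P) (d : ℕ) (hd : d + (2 * finrank ℝ V + 1) ≤ finrank ℝ W) :
    ∃ K : Submodule ℝ W, finrank ℝ K = d ∧ ∀ x y, P x - P y ∈ K → P x = P y := by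
  induction d with
  | zero => exact ⟨⊥, by simp, fun x y h ↦ by simpa [sub_eq_zero] using h⟩
  | succ d ih =>
    obtain ⟨K, hK, hsep⟩ := ih (by omega)
    let f : ℝ × V × V × K → W := fun p ↦ p.1 • (P p.2.1 - P p.2.2.1) + p.2.2.2
    have hf : ContDiff ℝ 1 f := by
      refine ContDiff.add (contDiff_fst.smul ?_) ?_
      · exact (hP.comp (contDiff_fst.comp contDiff_snd)).sub
          (hP.comp (contDiff_fst.comp (contDiff_snd.comp contDiff_snd)))
      · exact K.subtypeL.contDiff.comp (contDiff_snd.comp (contDiff_snd.comp contDiff_snd))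
    obtain ⟨v, hv⟩ := (hf.dense_compl_range_of_finrank_lt_finrank (by
      simp only [finrank_prod, finrank_self, hK]; omega)).nonempty
    have hvK : v ∉ K := fun h ↦ hv ⟨(0, 0, 0, ⟨v, h⟩), by simp [f]⟩
    refine ⟨K ⊔ Submodule.span ℝ {v}, by rw [Submodule.finrank_sup_span_singleton hvK, hK],
      fun x y h ↦ ?_⟩
    obtain ⟨k, hk, w, hw, hkw⟩ := Submodule.mem_sup.1 h
    obtain ⟨s, rfl⟩ := Submodule.mem_span_singleton.1 hw
    rcases eq_or_ne s 0 with rfl | hs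
    · exact hsep x y (by simpa [← hkw] using hk)
    · refine (hv ⟨(s⁻¹, x, y, -(s⁻¹ • ⟨k, hk⟩)), ?_⟩).elim
      simp [f, ← hkw, smul_smul, hs]

/-- The image of a `C¹` map from a space of dimension `v` can be linearly injected into any space
of dimension at least `2 * v + 1`. -/
theorem exists_linearMap_injOn_range.{u, v, w} {V : Type u} {W : Type v} {W' : Type w}
    [NormedAddCommGroup V] [NormedSpace ℝ V] [FiniteDimensional ℝ V]
    [NormedAddCommGroup W] [NormedSpace ℝ W] [FiniteDimensional ℝ W]
    [AddCommGroup W'] [Module ℝ W'] [FiniteDimensional ℝ W']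
    {P : V → W} (hP : ContDiff ℝ 1 P) (hW' : 2 * finrank ℝ V + 1 ≤ finrank ℝ W') :
    ∃ L : W →ₗ[ℝ] W', ∀ x y, L (P x) = L (P y) → P x = P y := by
  obtain ⟨K, hK, hsep⟩ : ∃ K : Submodule ℝ W, finrank ℝ W ≤ finrank ℝ K + finrank ℝ W' ∧
      ∀ x y, P x - P y ∈ K → P x = P y := by
    rcases le_total (2 * finrank ℝ V + 1) (finrank ℝ W) with h | h
    · obtain ⟨K, hK, hsep⟩ := exists_submodule_sub_mem_imp_eq hP
        (finrank ℝ W - (2 * finrank ℝ V + 1)) (by omega)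
      exact ⟨K, by omega, hsep⟩
    · exact ⟨⊥, by omega, fun x y h ↦ by simpa [sub_eq_zero] using h⟩
  have hrank :
      Cardinal.lift.{w} (Module.rank ℝ (W ⧸ K)) ≤ Cardinal.lift.{v} (Module.rank ℝ W') := by
    rw [← finrank_eq_rank, ← finrank_eq_rank, Cardinal.lift_natCast, Cardinal.lift_natCast,
      Nat.cast_le]
    have := K.finrank_quotient_add_finrank
    omega
  obtain ⟨g, hg⟩ := lift_rank_le_iff_exists_linearMap.1 hrank
  refine ⟨g ∘ₗ K.mkQ, fun x y h ↦ hsep x y ?_⟩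
  exact (Submodule.Quotient.eq K).1 (hg h)

/-- Radial contraction `x ↦ x / (1 + ‖x‖)` onto the open unit ball. -/
noncomputable def radialSquash {V : Type*} [NormedAddCommGroup V] [NormedSpace ℝ V] (x : V) : V :=
  (1 + ‖x‖)⁻¹ • x

section radialSquash

variable {V : Type*} [NormedAddCommGroup V] [NormedSpace ℝ V]

theorem norm_radialSquash (x : V) : ‖radialSquash x‖ = ‖x‖ / (1 + ‖x‖) := by
  rw [radialSquash, norm_smul, norm_inv, Real.norm_of_nonneg (by positivity)]
  ring

theorem norm_radialSquash_le_one (x : V) : ‖radialSquash x‖ ≤ 1 := by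
  rw [norm_radialSquash, div_le_one (by positivity)]
  linarith

theorem radialSquash_injective : Function.Injective (radialSquash : V → V) := by
  intro x y h
  have hn : ‖x‖ = ‖y‖ := by
    have := congrArg norm h
    rw [norm_radialSquash, norm_radialSquash, div_eq_div_iff (by positivity)
      (by positivity)] at this
    linarith
  have h0 : (1 + ‖y‖)⁻¹ ≠ 0 := by positivity
  simpa [radialSquash, hn, h0] using h

theorem norm_radialSquash_sub_le (x y : V) :
    ‖radialSquash x - radialSquash y‖ ≤ 2 * ‖x - y‖ := by
  have hx : 0 < 1 + ‖x‖ := by positivity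
  have hy : 0 < 1 + ‖y‖ := by positivity
  have key : radialSquash x - radialSquash y =
      (1 + ‖x‖)⁻¹ • (x - y) + ((1 + ‖x‖)⁻¹ * (‖y‖ - ‖x‖)) • radialSquash y := by
    have : (1 + ‖y‖)⁻¹ = (1 + ‖x‖)⁻¹ - (1 + ‖x‖)⁻¹ * (‖y‖ - ‖x‖) * (1 + ‖y‖)⁻¹ := by
      field_simp
      ring
    simp only [radialSquash, smul_sub, smul_smul]
    nth_rewrite 1 [this]
    module
  have hinv : (1 + ‖x‖)⁻¹ ≤ 1 := inv_le_one_of_one_le₀ (by simp)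
  have habs : |‖y‖ - ‖x‖| ≤ ‖x - y‖ := by
    rw [abs_sub_comm]
    exact abs_norm_sub_norm_le x y
  calc ‖radialSquash x - radialSquash y‖
      ≤ (1 + ‖x‖)⁻¹ * ‖x - y‖ + (1 + ‖x‖)⁻¹ * |‖y‖ - ‖x‖| * ‖radialSquash y‖ := by
        rw [key]
        refine (norm_add_le _ _).trans (le_of_eq ?_)
        rw [norm_smul, norm_smul, norm_mul, Real.norm_of_nonneg (inv_nonneg.2 hx.le),
          Real.norm_eq_abs]
    _ ≤ 1 * ‖x - y‖ + 1 * ‖x - y‖ * 1 := by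
        gcongr
        exact norm_radialSquash_le_one y
    _ = 2 * ‖x - y‖ := by ring

end radialSquash

open Polynomial in
/-- Finitely many `C¹` invariants separate the orbits of a cyclic group acting linearly. -/
theorem exists_contDiff_invariant_separating {n m : ℕ} (hm : 0 < m)
    (A : EuclideanSpace ℂ (Fin n) →ₗ[ℂ] EuclideanSpace ℂ (Fin n)) (hA : A ^ m = 1) :
    ∃ P : EuclideanSpace ℂ (Fin n) → Fin (m + 1) × Fin (m * n + 1) → ℂ, ContDiff ℝ 1 P ∧
      (∀ x, P (A x) = P x) ∧ ∀ x y, P x = P y → ∃ k : ℕ, x = (A ^ k) y := by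
  let q : EuclideanSpace ℂ (Fin n) → ℂ[X] := fun x ↦ ∑ j, C (x j) * X ^ (j : ℕ)
  have hqc (x) (j : Fin n) : (q x).coeff j = x j := by
    simp [q, coeff_C_mul, coeff_X_pow, Fin.val_inj]
  have hqd (x) : (q x).natDegree ≤ n :=
    natDegree_sum_le_of_forall_le _ _ fun j _ ↦ (natDegree_C_mul_X_pow_le _ _).trans j.2.le
  let P : EuclideanSpace ℂ (Fin n) → (Fin (m + 1) × Fin (m * n + 1)) → ℂ := fun x p ↦
    ∏ k ∈ Finset.range m, ((p.1 : ℂ) - (q ((A ^ k) x)).eval (p.2 : ℂ))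
  refine ⟨P, ?_, fun x ↦ ?_, fun x y h ↦ ?_⟩
  · refine contDiff_pi.2 fun i ↦ contDiff_prod fun k _ ↦ contDiff_const.sub ?_
    simp only [q, eval_finsetSum, eval_mul, eval_C, eval_pow, eval_X]
    refine ContDiff.sum fun j _ ↦ ContDiff.mul ?_ contDiff_const
    exact (((EuclideanSpace.proj j : EuclideanSpace ℂ (Fin n) →L[ℂ] ℂ).restrictScalars ℝ).comp
      ((LinearMap.toContinuousLinearMap (A ^ k)).restrictScalars ℝ)).contDiff
  · funext i
    obtain ⟨m, rfl⟩ := Nat.exists_eq_succ_of_ne_zero hm.ne'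
    have hshift (k : ℕ) : (A ^ k) (A x) = (A ^ (k + 1)) x := by rw [pow_succ]; rfl
    simp only [P, hshift]
    rw [Finset.prod_range_succ, Finset.prod_range_succ' _ m, hA, pow_zero]
  · by_contra! hne
    have hq (k : ℕ) : q x - q ((A ^ k) y) ≠ 0 := fun h0 ↦ hne k <| by
      ext j
      rw [← hqc, sub_eq_zero.1 h0, hqc]
    let R : ℂ[X] := ∏ k ∈ Finset.range m, (q x - q ((A ^ k) y))
    have hR : R ≠ 0 := Finset.prod_ne_zero_iff.2 fun k _ ↦ hq k
    have hRd : R.natDegree ≤ m * n := by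
      refine (natDegree_prod_le _ _).trans ((Finset.sum_le_card_nsmul _ _ n fun k _ ↦ ?_).trans ?_)
      · exact (natDegree_sub_le _ _).trans (max_le (hqd _) (hqd _))
      · simp
    obtain ⟨t, ht⟩ : ∃ t : Fin (m * n + 1), R.eval (t : ℂ) ≠ 0 := by
      by_contra! h0
      refine hR (eq_of_natDegree_lt_card_of_eval_eq R 0
        (f := fun t : Fin (m * n + 1) ↦ ((t : ℕ) : ℂ)) ?_ (by simpa using h0) ?_)
      · exact Nat.cast_injective.comp Fin.val_injective
      · simpa using Nat.lt_succ_of_le hRd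
    let S : EuclideanSpace ℂ (Fin n) → ℂ[X] := fun z ↦
      ∏ k ∈ Finset.range m, (X - C ((q ((A ^ k) z)).eval (t : ℂ)))
    have hS (z) : (S z).natDegree = m := by simp [S]
    have hSS : S x = S y := by
      refine eq_of_natDegree_lt_card_of_eval_eq _ _
        (f := fun t : Fin (m + 1) ↦ ((t : ℕ) : ℂ))
        (Nat.cast_injective.comp Fin.val_injective) (fun c ↦ ?_) (by simp [hS])
      simpa [S, P, eval_prod] using congrFun h (c, t)
    apply ht
    have h1 : (S x).eval ((q x).eval (t : ℂ)) = 0 := by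
      rw [eval_prod]
      exact Finset.prod_eq_zero (Finset.mem_range.2 hm) (by simp)
    rw [hSS] at h1
    simpa [S, R, eval_prod] using h1

/-- Linear isometries of finite order admit Lipschitz invariants that separate orbits. -/
theorem exists_lipschitzWith_invariant_separating {n m : ℕ} (hm : 0 < m)
    (A : EuclideanSpace ℂ (Fin n) →ₗ[ℂ] EuclideanSpace ℂ (Fin n)) (hA : A ^ m = 1)
    (hnorm : ∀ x, ‖A x‖ = ‖x‖) :
    ∃ (Ψ : EuclideanSpace ℂ (Fin n) → EuclideanSpace ℂ (Fin (2 * n + 1))) (B : ℝ), 0 < B ∧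
      (∀ x, Ψ (A x) = Ψ x) ∧ (∀ x y, Ψ x = Ψ y → ∃ k : ℕ, x = (A ^ k) y) ∧
      ∀ x y, ‖Ψ x - Ψ y‖ ≤ B * ‖x - y‖ := by
  obtain ⟨P, hP, hinv, hsep⟩ := exists_contDiff_invariant_separating hm A hA
  have hfin (d : ℕ) : finrank ℝ (EuclideanSpace ℂ (Fin d)) = 2 * d := by
    rw [← finrank_mul_finrank ℝ ℂ (EuclideanSpace ℂ (Fin d))]
    simp
  obtain ⟨L, hL⟩ := exists_linearMap_injOn_range
    (W' := EuclideanSpace ℂ (Fin (2 * n + 1))) hP (by rw [hfin, hfin]; omega)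
  have hLP : ContDiff ℝ 1 fun x ↦ L (P x) := (LinearMap.toContinuousLinearMap L).contDiff.comp hP
  obtain ⟨B, hB⟩ := hLP.contDiffOn.exists_lipschitzOnWith one_ne_zero
    (convex_closedBall (0 : EuclideanSpace ℂ (Fin n)) 1) (isCompact_closedBall _ _)
  have hsq (k : ℕ) (x) : radialSquash ((A ^ k) x) = (A ^ k) (radialSquash x) := by
    have : ‖(A ^ k) x‖ = ‖x‖ := by
      induction k with
      | zero => rfl
      | succ k ih => rw [pow_succ', Module.End.mul_apply, hnorm, ih]
    rw [radialSquash, this, radialSquash, LinearMap.map_smul_of_tower]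
  refine ⟨fun x ↦ L (P (radialSquash x)), 2 * B + 1, by positivity, fun x ↦ ?_, fun x y h ↦ ?_,
    fun x y ↦ ?_⟩
  · have := hsq 1 x
    rw [pow_one] at this
    simp only [this, hinv]
  · obtain ⟨k, hk⟩ := hsep _ _ (hL _ _ h)
    exact ⟨k, radialSquash_injective (hk.trans (hsq k y).symm)⟩
  · have hmem (z : EuclideanSpace ℂ (Fin n)) : radialSquash z ∈ Metric.closedBall 0 1 := by
      simpa using norm_radialSquash_le_one z
    calc ‖L (P (radialSquash x)) - L (P (radialSquash y))‖
        ≤ B * ‖radialSquash x - radialSquash y‖ := hB.norm_sub_le (hmem x) (hmem y)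
      _ ≤ B * (2 * ‖x - y‖) := by gcongr; exact norm_radialSquash_sub_le x y
      _ ≤ (2 * B + 1) * ‖x - y‖ := by nlinarith [norm_nonneg (x - y)]

/-- For every positive integer `m` there is a constant `C > 0`
(depending only on `m`) such that for every positive integer `n` and every unitary
matrix `T ∈ U(n)` with `T ^ m = 1` (so that `ℤ_m` acts on `ℂ^n` by `k • x = T^k x`),
there is a map `Φ : ℂ^n → ℂ^(2n+1)` which is `ℤ_m`-invariant, separates the orbits of
the action, and is `C`-Lipschitz with respect to the orbit distance
`d([x],[y]) = min_{0 ≤ k < m} ‖x - T^k y‖`. -/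
theorem translation_invariant_lipschitz_measurements
    (m : ℕ) (hm : 0 < m) :
    ∃ C : ℝ, 0 < C ∧
      ∀ (n : ℕ), 0 < n →
        ∀ T : Matrix (Fin n) (Fin n) ℂ, T ∈ Matrix.unitaryGroup (Fin n) ℂ → T ^ m = 1 →
          ∃ Φ : EuclideanSpace ℂ (Fin n) → EuclideanSpace ℂ (Fin (2 * n + 1)),
            (∀ x : EuclideanSpace ℂ (Fin n), Φ (Matrix.toEuclideanLin T x) = Φ x) ∧
            (∀ x y : EuclideanSpace ℂ (Fin n),
              Φ x = Φ y ↔ ∃ k : ℕ, x = Matrix.toEuclideanLin (T ^ k) y) ∧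
            (∀ x y : EuclideanSpace ℂ (Fin n),
              ‖Φ x - Φ y‖ ≤ C * ⨅ k : Fin m, ‖x - Matrix.toEuclideanLin (T ^ (k : ℕ)) y‖) := by
  refine ⟨1, one_pos, fun n _ T hT hTm ↦ ?_⟩
  have hnorm (x : EuclideanSpace ℂ (Fin n)) : ‖Matrix.toEuclideanLin T x‖ = ‖x‖ := by
    rw [← Matrix.coe_toEuclideanCLM_eq_toEuclideanLin]
    exact ContinuousLinearMap.norm_map_of_mem_unitary
      (Unitary.map_mem (Matrix.toEuclideanCLM (n := Fin n) (𝕜 := ℂ)) hT) x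
  obtain ⟨Ψ, B, hB, hinv, hsep, hlip⟩ := exists_lipschitzWith_invariant_separating hm
    (Matrix.toEuclideanLin T) (by rw [← Matrix.toLpLin_pow, hTm, Matrix.toLpLin_one]; rfl) hnorm
  have hinvk (k : ℕ) (x) : Ψ (Matrix.toEuclideanLin (T ^ k) x) = Ψ x := by
    rw [Matrix.toLpLin_pow]
    induction k with
    | zero => rfl
    | succ k ih => rw [pow_succ', Module.End.mul_apply, hinv, ih]
  have : Nonempty (Fin m) := ⟨⟨0, hm⟩⟩
  refine ⟨fun x ↦ (B⁻¹ : ℝ) • Ψ x, fun x ↦ by simp only [hinv],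
    fun x y ↦ ⟨fun h ↦ ?_, ?_⟩, fun x y ↦ ?_⟩
  · obtain ⟨k, hk⟩ := hsep x y (smul_right_injective _ (inv_ne_zero hB.ne') h)
    exact ⟨k, by rwa [Matrix.toLpLin_pow]⟩
  · rintro ⟨k, rfl⟩
    simp only [hinvk]
  · rw [one_mul]
    refine le_ciInf fun k ↦ ?_
    rw [← smul_sub, norm_smul, Real.norm_of_nonneg (inv_nonneg.2 hB.le), ← hinvk k y,
      inv_mul_le_iff₀ hB]
    exact hlip _ _
end

section
/- Let a finite group G act on ℂ^n through a unitary representation σ : G → U(n), and let H : ℂ^n → ℂ^N be a G-invariant continuously differentiable map. Let B = max_{‖z‖=1} ‖H(z)‖, let L ≥ 0 be a Lipschitz constant for the restriction of H to the unit sphere (i.e. ‖H(u) − H(v)‖ ≤ L‖u − v‖ for all unit vectors u, v), and set C = max{L, B}. Then the map Φ_H (defined by Φ_H(x) = ‖x‖ H(x/‖x‖) for x ≠ 0 and Φ_H(0) = 0) satisfies ‖Φ_H(x) − Φ_H(y)‖ ≤ 3C ‖x − y‖ for all x, y ∈ ℂ^n, and consequently ‖Φ_H(x) − Φ_H(y)‖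 ≤ 3C · inf_{g ∈ G} ‖x − σ(g) y‖ for all x, y ∈ ℂ^n. -/
open scoped Classical

/-- For a map `F : ℂ^n → ℂ^N`, the radially extended map
`Φ_F(x) = ‖x‖ • F(x/‖x‖)` for `x ≠ 0`, `Φ_F(0) = 0`. -/
noncomputable def PhiMap {n N : ℕ}
    (F : EuclideanSpace ℂ (Fin n) → EuclideanSpace ℂ (Fin N))
    (x : EuclideanSpace ℂ (Fin n)) : EuclideanSpace ℂ (Fin N) :=
  if x = 0 then 0 else ‖x‖ • F (‖x‖⁻¹ • x)

lemma norm_inv_norm_smul_eq_one {E : Type*} [NormedAddCommGroup E] [NormedSpace ℝ E] {x : E}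
    (hx : x ≠ 0) : ‖‖x‖⁻¹ • x‖ = 1 := by
  rw [norm_smul, norm_inv, norm_norm, inv_mul_cancel₀ (norm_ne_zero_iff.2 hx)]

lemma norm_mul_norm_normalize_sub_le {E : Type*} [NormedAddCommGroup E] [NormedSpace ℝ E] {x y : E}
    (hx : x ≠ 0) (hy : y ≠ 0) :
    ‖x‖ * ‖‖x‖⁻¹ • x - ‖y‖⁻¹ • y‖ ≤ 2 * ‖x - y‖ := by
  have hx' : ‖x‖ ≠ 0 := norm_ne_zero_iff.2 hx
  have hy' : ‖y‖ ≠ 0 := norm_ne_zero_iff.2 hy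
  have key : ‖x‖ • (‖x‖⁻¹ • x - ‖y‖⁻¹ • y) = (x - y) + (‖y‖ - ‖x‖) • (‖y‖⁻¹ • y) := by
    rw [smul_sub, sub_smul, smul_inv_smul₀ hx', smul_inv_smul₀ hy']
    abel
  calc ‖x‖ * ‖‖x‖⁻¹ • x - ‖y‖⁻¹ • y‖ = ‖(x - y) + (‖y‖ - ‖x‖) • (‖y‖⁻¹ • y)‖ := by
        rw [← key, norm_smul, norm_norm]
    _ ≤ ‖x - y‖ + |‖y‖ - ‖x‖| := by
        refine (norm_add_le _ _).trans_eq ?_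
        rw [norm_smul (‖y‖ - ‖x‖), norm_inv_norm_smul_eq_one hy, mul_one, Real.norm_eq_abs]
    _ ≤ 2 * ‖x - y‖ := by
        have := abs_norm_sub_norm_le y x
        rw [norm_sub_rev y x] at this
        linarith

lemma norm_PhiMap_le {n N : ℕ} {F : EuclideanSpace ℂ (Fin n) → EuclideanSpace ℂ (Fin N)} {C : ℝ}
    (hF : ∀ u, ‖u‖ = 1 → ‖F u‖ ≤ C) (x : EuclideanSpace ℂ (Fin n)) :
    ‖PhiMap F x‖ ≤ C * ‖x‖ := by
  unfold PhiMap
  split_ifs with hx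
  · simp [hx]
  · rw [norm_smul, norm_norm, mul_comm]
    exact mul_le_mul_of_nonneg_right (hF _ (norm_inv_norm_smul_eq_one hx)) (norm_nonneg x)

lemma norm_PhiMap_sub_le {n N : ℕ} {F : EuclideanSpace ℂ (Fin n) → EuclideanSpace ℂ (Fin N)}
    {C : ℝ} (hC : 0 ≤ C) (hF : ∀ u, ‖u‖ = 1 → ‖F u‖ ≤ C)
    (hLip : ∀ u v, ‖u‖ = 1 → ‖v‖ = 1 → ‖F u - F v‖ ≤ C * ‖u - v‖)
    (x y : EuclideanSpace ℂ (Fin n)) :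
    ‖PhiMap F x - PhiMap F y‖ ≤ 3 * C * ‖x - y‖ := by
  have hCle : ∀ z : EuclideanSpace ℂ (Fin n), C * ‖z‖ ≤ 3 * C * ‖z‖ := fun z => by
    nlinarith [mul_nonneg hC (norm_nonneg z)]
  rcases eq_or_ne x 0 with rfl | hx
  · have h0 : PhiMap F 0 = 0 := if_pos rfl
    rw [h0, zero_sub, zero_sub, norm_neg, norm_neg]
    exact (norm_PhiMap_le hF y).trans (hCle y)
  rcases eq_or_ne y 0 with rfl | hy
  · have h0 : PhiMap F 0 = 0 := if_pos rfl
    rw [h0, sub_zero, sub_zero]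
    exact (norm_PhiMap_le hF x).trans (hCle x)
  have hu := norm_inv_norm_smul_eq_one hx
  have hv := norm_inv_norm_smul_eq_one hy
  rw [PhiMap, PhiMap, if_neg hx, if_neg hy]
  have hdist := norm_mul_norm_normalize_sub_le hx hy
  set u := ‖x‖⁻¹ • x
  set v := ‖y‖⁻¹ • y
  have key : ‖x‖ • F u - ‖y‖ • F v = ‖x‖ • (F u - F v) + (‖x‖ - ‖y‖) • F v := by
    rw [smul_sub, sub_smul]
    abel
  calc ‖‖x‖ • F u - ‖y‖ • F v‖ ≤ ‖x‖ * ‖F u - F v‖ + |‖x‖ - ‖y‖| * ‖F v‖ := by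
        rw [key]
        refine (norm_add_le _ _).trans_eq ?_
        rw [norm_smul, norm_smul, norm_norm, Real.norm_eq_abs]
    _ ≤ ‖x‖ * (C * ‖u - v‖) + ‖x - y‖ * C := by
        gcongr
        · exact hLip u v hu hv
        · exact abs_norm_sub_norm_le x y
        · exact hF v hv
    _ ≤ 3 * C * ‖x - y‖ := by nlinarith [mul_le_mul_of_nonneg_left hdist hC]

lemma PhiMap_apply_of_invariant {n N : ℕ}
    {F : EuclideanSpace ℂ (Fin n) → EuclideanSpace ℂ (Fin N)}
    (e : EuclideanSpace ℂ (Fin n) ≃ₗᵢ[ℂ] EuclideanSpace ℂ (Fin n))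
    (hF : ∀ x, F (e x) = F x) (x : EuclideanSpace ℂ (Fin n)) :
    PhiMap F (e x) = PhiMap F x := by
  have hsmul : ‖x‖⁻¹ • e x = e (‖x‖⁻¹ • x) :=
    (LinearMap.map_smul_of_tower e.toLinearEquiv.toLinearMap ‖x‖⁻¹ x).symm
  simp only [PhiMap, EmbeddingLike.map_eq_zero_iff, e.norm_map, hsmul, hF]

/-- If `H : ℂ^n → ℂ^N` is a `C¹`, `G`-invariant map (for a unitary
representation `σ` of a finite group `G`), `B` is the maximum of `‖H‖` on the unit
sphere, `L ≥ 0` is a Lipschitz constant for `H` restricted to the unit sphere, and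
`C = max L B`, then `Φ_H` is `3C`-Lipschitz, and consequently `3C`-Lipschitz with
respect to the orbit pseudodistance `inf_{g ∈ G} ‖x - σ(g) y‖`. -/
theorem PhiMap_lipschitz
    {n N : ℕ} {G : Type*} [Group G] [Finite G]
    (σ : G →* (EuclideanSpace ℂ (Fin n) ≃ₗᵢ[ℂ] EuclideanSpace ℂ (Fin n)))
    (H : EuclideanSpace ℂ (Fin n) → EuclideanSpace ℂ (Fin N))
    (hinv : ∀ (g : G) (x : EuclideanSpace ℂ (Fin n)), H (σ g x) = H x)
    (hC1 : ContDiff ℝ 1 H)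
    (B : ℝ) (hB : IsGreatest ((fun z => ‖H z‖) '' {z : EuclideanSpace ℂ (Fin n) | ‖z‖ = 1}) B)
    (L : ℝ) (hL0 : 0 ≤ L)
    (hL : ∀ u v : EuclideanSpace ℂ (Fin n), ‖u‖ = 1 → ‖v‖ = 1 → ‖H u - H v‖ ≤ L * ‖u - v‖) :
    (∀ x y : EuclideanSpace ℂ (Fin n),
      ‖PhiMap H x - PhiMap H y‖ ≤ 3 * max L B * ‖x - y‖) ∧
    (∀ x y : EuclideanSpace ℂ (Fin n),
      ‖PhiMap H x - PhiMap H y‖ ≤ 3 * max L B * ⨅ g : G, ‖x - σ g y‖) := by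
  have hC : 0 ≤ max L B := le_max_of_le_left hL0
  have hLip := norm_PhiMap_sub_le hC
    (fun u hu => (hB.2 ⟨u, hu, rfl⟩).trans (le_max_right L B))
    (fun u v hu hv => (hL u v hu hv).trans
      (mul_le_mul_of_nonneg_right (le_max_left L B) (norm_nonneg _)))
  refine ⟨hLip, fun x y => ?_⟩
  rw [Real.mul_iInf_of_nonneg (mul_nonneg zero_le_three hC)]
  refine le_ciInf fun g => ?_
  rw [← PhiMap_apply_of_invariant (σ g) (hinv g) y]
  exact hLip x (σ g y)
end

section
/- Let p be a prime, ζ = e^{2πi/p}, and M = diag(1, ζ, ζ², …, ζ^{p−1}) acting on ℂ^p (with coordinates indexed 0,…,p−1). Define F : ℂ^p → ℂ^{2p−2} by F(x) = (x_0, x_1^p, x_2^p, …, x_{p−1}^p, x_1^{p−2} x_2, x_1^{p−3} x_3, …, x_1^{p−k} x_k, …, x_1 x_{p−1}). Then: (i) F(M^k x) = F(x) for every x ∈ ℂ^p and every integer k; and (ii) if F(x) = F(y) and x_1 ≠ 0, then x = M^k y for some integer k. -/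
/-- Index type of cardinality `2p - 2`: the indices `0, …, p-1` of the block
`(x_0, x_1^p, …, x_{p-1}^p)` together with the indices `2 ≤ k ≤ p-1` of the block
`(x_1^{p-k} x_k)`. -/
abbrev ModIdx (p : ℕ) := Fin p ⊕ {k : Fin p // 2 ≤ (k : ℕ)}

/-- The invariant map
`F(x) = (x_0, x_1^p, …, x_{p-1}^p, x_1^{p-2} x_2, …, x_1^{p-k} x_k, …, x_1 x_{p-1})`
on `ℂ^p`, `p` prime. -/
noncomputable def Fmod (p : ℕ) (hp : p.Prime) (x : Fin p → ℂ) : ModIdx p → ℂ :=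
  fun i => match i with
    | Sum.inl j => if (j : ℕ) = 0 then x j else x j ^ p
    | Sum.inr k => x ⟨1, hp.one_lt⟩ ^ (p - (k : ℕ)) * x k.1

/-- The action of the `k`-th power of the modulation matrix
`M = diag(1, ζ, ζ², …, ζ^{p-1})` on `ℂ^p`. -/
def Mact (p : ℕ) (ζ : ℂ) (k : ℕ) (x : Fin p → ℂ) : Fin p → ℂ :=
  fun j => ζ ^ ((j : ℕ) * k) * x j

/-- Let `p` be prime, `ζ = e^{2πi/p}`, and let `ℤ_p` act on `ℂ^p`
through powers of `M = diag(1, ζ, …, ζ^{p-1})`. Then the map `F` above is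
`M`-invariant, and if `F(x) = F(y)` with `x_1 ≠ 0` then `x = M^k y` for some `k`. -/
theorem modulation_invariants_separate
    (p : ℕ) (hp : p.Prime) (ζ : ℂ)
    (hζ : ζ = Complex.exp (2 * Real.pi * Complex.I / p)) :
    (∀ (x : Fin p → ℂ) (k : ℕ), Fmod p hp (Mact p ζ k x) = Fmod p hp x) ∧
    (∀ x y : Fin p → ℂ, Fmod p hp x = Fmod p hp y → x ⟨1, hp.one_lt⟩ ≠ 0 →
      ∃ k : ℕ, x = Mact p ζ k y) := by
  have hprim : IsPrimitiveRoot ζ p := hζ ▸ Complex.isPrimitiveRoot_exp p hp.ne_zero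
  have hζp : ζ ^ p = 1 := hprim.pow_eq_one
  have hpow (n : ℕ) : ζ ^ (p * n) = 1 := by rw [pow_mul, hζp, one_pow]
  refine ⟨fun x k => ?_, fun x y h hx => ?_⟩
  · funext i
    rcases i with j | ⟨j, hj⟩
    · by_cases h0 : (j : ℕ) = 0
      · simp [Fmod, Mact, h0]
      · simp only [Fmod, Mact, if_neg h0]
        rw [mul_pow, ← pow_mul, mul_comm _ p, hpow, one_mul]
    · have hexp : 1 * k * (p - (j : ℕ)) + j * k = p * k := by
        rw [one_mul, mul_comm k, ← add_mul, Nat.sub_add_cancel j.isLt.le]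
      simp only [Fmod, Mact]
      rw [mul_pow, ← pow_mul, mul_mul_mul_comm, ← pow_add, hexp, hpow, one_mul]
  · have h1 : x ⟨1, hp.one_lt⟩ ^ p = y ⟨1, hp.one_lt⟩ ^ p := by
      simpa [Fmod] using congrFun h (Sum.inl ⟨1, hp.one_lt⟩)
    have hy : y ⟨1, hp.one_lt⟩ ≠ 0 := by
      intro hy
      rw [hy, zero_pow hp.ne_zero] at h1
      exact hx (eq_zero_of_pow_eq_zero h1)
    have : NeZero p := ⟨hp.ne_zero⟩
    obtain ⟨k, -, hk⟩ := hprim.eq_pow_of_pow_eq_one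
      (ξ := x ⟨1, hp.one_lt⟩ / y ⟨1, hp.one_lt⟩)
      (by rw [div_pow, h1, div_self (pow_ne_zero _ hy)])
    have hxy : x ⟨1, hp.one_lt⟩ = ζ ^ k * y ⟨1, hp.one_lt⟩ := by
      rw [hk, div_mul_cancel₀ _ hy]
    refine ⟨k, funext fun j => ?_⟩
    rcases lt_or_ge (j : ℕ) 2 with hj | hj
    · obtain ⟨j, hjp⟩ := j
      obtain rfl | rfl : j = 0 ∨ j = 1 := by simp only at hj; omega
      · simpa [Fmod, Mact] using congrFun h (Sum.inl ⟨0, hjp⟩)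
      · simpa [Mact] using hxy
    · have hj' : x ⟨1, hp.one_lt⟩ ^ (p - (j : ℕ)) * x j
          = y ⟨1, hp.one_lt⟩ ^ (p - (j : ℕ)) * y j := congrFun h (Sum.inr ⟨j, hj⟩)
      rw [hxy, mul_pow, mul_right_comm, mul_comm _ (y _ ^ _)] at hj'
      have hyj := mul_left_cancel₀ (pow_ne_zero _ hy) hj'
      have hexp : (j : ℕ) * k + k * (p - j) = p * k := by
        rw [mul_comm k, ← add_mul, Nat.add_sub_cancel' j.isLt.le]
      rw [Mact, ← hyj, ← pow_mul, ← mul_assoc, ← pow_add, hexp, hpow, one_mul]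
end
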